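/- Let n = 2(k+m)+5 and let S and d₁ be as in the context. Let R = ℝ[x_{ab} : 1 ≤ a < b ≤ n] be the polynomial ring in the above-diagonal matrix entries (the coordinate ring of UT(n,ℝ)), regard d₁ as an element of R, and let R' be the localization of R at the powers of d₁. Every element of S lies in R' (each denominator Δ(c) is a product of factors of d₁, hence invertible in R'). Then the ideal I' of R' generated by S is a prime ideal. -/

import Mathlib

open Matrix

noncomputable section

/-- The coordinate ring `R = ℝ[x_{ab} : 1 ≤ a < b ≤ n]` of the group `UT(n,ℝ)`. -/
abbrev CoordRing (n : ℕ) := MvPolynomial {p : Fin n × Fin n // p.1 < p.2} ℝ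

/-- The generic unitriangular matrix, whose above-diagonal entries are the variables
`x_{ab}`, with `1`'s on the diagonal and `0`'s below. -/
def genMat (n : ℕ) : Matrix (Fin n) (Fin n) (CoordRing n) :=
  Matrix.of fun i j =>
    if h : i < j then MvPolynomial.X ⟨(i, j), h⟩ else if i = j then 1 else 0

section Indices

variable (k m : ℕ)

/-- Rows (and columns) of block `1` in the partition `(m,1,1,k,1,k,1,1,m)` of `n = 2(k+m)+5`. -/
def r1 (a : Fin m) : Fin (2*(k+m)+5) := ⟨a.val, by have := a.isLt; omega⟩
/-- The row/column of the `1×1` block `2`. -/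
def i2 : Fin (2*(k+m)+5) := ⟨m, by omega⟩
/-- The row/column of the `1×1` block `3`. -/
def i3 : Fin (2*(k+m)+5) := ⟨m+1, by omega⟩
/-- Rows (and columns) of block `4`. -/
def r4 (a : Fin k) : Fin (2*(k+m)+5) := ⟨m+2+a.val, by have := a.isLt; omega⟩
/-- The row/column of the `1×1` block `5`. -/
def i5 : Fin (2*(k+m)+5) := ⟨m+k+2, by omega⟩
/-- Rows (and columns) of block `6`. -/
def c6 (a : Fin k) : Fin (2*(k+m)+5) := ⟨m+k+3+a.val, by have := a.isLt; omega⟩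
/-- The row/column of the `1×1` block `7`. -/
def i7 : Fin (2*(k+m)+5) := ⟨m+2*k+3, by omega⟩
/-- The row/column of the `1×1` block `8`. -/
def i8 : Fin (2*(k+m)+5) := ⟨m+2*k+4, by omega⟩
/-- Rows (and columns) of block `9`. -/
def c9 (a : Fin m) : Fin (2*(k+m)+5) := ⟨m+2*k+5+a.val, by have := a.isLt; omega⟩

/-- The polynomial `d₁ = C₂₃ · det C₄₆ · C₇₈`. -/
def dPoly : CoordRing (2*(k+m)+5) :=
  genMat (2*(k+m)+5) (i2 k m) (i3 k m)
    * ((genMat (2*(k+m)+5)).submatrix (r4 k m) (c6 k m)).det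
    * genMat (2*(k+m)+5) (i7 k m) (i8 k m)

/-- `R'`, the localization of the coordinate ring at the powers of `d₁`. -/
abbrev LocRing := Localization.Away (dPoly k m)

/-- The canonical map `R → R'`. -/
def toLoc : CoordRing (2*(k+m)+5) →+* LocRing k m := algebraMap _ _

/-- The set `S = S₀ ∪ S₁ ∪ S₂`, viewed inside the localization `R'`; the elements of `S₁`
are `c̃ = ±Δ(c)⁻¹·Δ̃(c)`, the denominators `Δ(c)` being invertible in `R'`. -/
def SPoly (γ₁ γ₂ : ℝ) : Set (LocRing k m) :=
  -- S₀ : strictly-above-diagonal entries of the diagonal blocks (1,1), (4,4), (6,6), (9,9)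
  {x | ∃ a b : Fin m, a < b ∧ x = toLoc k m (genMat (2*(k+m)+5) (r1 k m a) (r1 k m b))} ∪
  {x | ∃ a b : Fin k, a < b ∧ x = toLoc k m (genMat (2*(k+m)+5) (r4 k m a) (r4 k m b))} ∪
  {x | ∃ a b : Fin k, a < b ∧ x = toLoc k m (genMat (2*(k+m)+5) (c6 k m a) (c6 k m b))} ∪
  {x | ∃ a b : Fin m, a < b ∧ x = toLoc k m (genMat (2*(k+m)+5) (c9 k m a) (c9 k m b))} ∪
  -- S₁ : block (1,2), Φ'(c) = ∅
  (Set.range fun a : Fin m => toLoc k m (genMat (2*(k+m)+5) (r1 k m a) (i2 k m))) ∪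
  -- S₁ : block (1,4), Φ'(c) = {(2,3)}
  (Set.range fun p : Fin m × Fin k =>
    - Ring.inverse (toLoc k m (genMat (2*(k+m)+5) (i2 k m) (i3 k m)))
      * toLoc k m ((genMat (2*(k+m)+5)).submatrix
          ![r1 k m p.1, i2 k m] ![i3 k m, r4 k m p.2]).det) ∪
  -- S₁ : block (1,5), Φ'(c) = {(2,3)}
  (Set.range fun a : Fin m =>
    - Ring.inverse (toLoc k m (genMat (2*(k+m)+5) (i2 k m) (i3 k m)))
      * toLoc k m ((genMat (2*(k+m)+5)).submatrix
          ![r1 k m a, i2 k m] ![i3 k m, i5 k m]).det) ∪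
  -- S₁ : block (1,7), Φ'(c) = {(2,3),(4,6)}
  (Set.range fun a : Fin m =>
    (-1 : LocRing k m)^(k+1)
      * Ring.inverse (toLoc k m ((genMat (2*(k+m)+5)).submatrix
          (Fin.cons (i2 k m) (r4 k m)) (Fin.cons (i3 k m) (c6 k m))).det)
      * toLoc k m ((genMat (2*(k+m)+5)).submatrix
          (Fin.cons (r1 k m a) (Fin.cons (i2 k m) (r4 k m)))
          (Fin.snoc (Fin.cons (i3 k m) (c6 k m)) (i7 k m))).det) ∪
  -- S₁ : block (3,4), Φ'(c) = ∅
  (Set.range fun b : Fin k => toLoc k m (genMat (2*(k+m)+5) (i3 k m) (r4 k m b))) ∪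
  -- S₁ : block (3,5), Φ'(c) = ∅
  {toLoc k m (genMat (2*(k+m)+5) (i3 k m) (i5 k m))} ∪
  -- S₁ : block (3,7), Φ'(c) = {(4,6)}
  {(-1 : LocRing k m)^k
    * Ring.inverse (toLoc k m ((genMat (2*(k+m)+5)).submatrix (r4 k m) (c6 k m)).det)
    * toLoc k m ((genMat (2*(k+m)+5)).submatrix
        (Fin.cons (i3 k m) (r4 k m)) (Fin.snoc (c6 k m) (i7 k m))).det} ∪
  -- S₁ : block (3,9), Φ'(c) = {(4,6),(7,8)}
  (Set.range fun b : Fin m =>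
    (-1 : LocRing k m)^(k+1)
      * Ring.inverse (toLoc k m ((genMat (2*(k+m)+5)).submatrix
          (Fin.snoc (r4 k m) (i7 k m)) (Fin.snoc (c6 k m) (i8 k m))).det)
      * toLoc k m ((genMat (2*(k+m)+5)).submatrix
          (Fin.cons (i3 k m) (Fin.snoc (r4 k m) (i7 k m)))
          (Fin.snoc (Fin.snoc (c6 k m) (i8 k m)) (c9 k m b))).det) ∪
  -- S₁ : block (4,5), Φ'(c) = ∅
  (Set.range fun a : Fin k => toLoc k m (genMat (2*(k+m)+5) (r4 k m a) (i5 k m))) ∪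
  -- S₁ : block (5,6), Φ'(c) = ∅
  (Set.range fun b : Fin k => toLoc k m (genMat (2*(k+m)+5) (i5 k m) (c6 k m b))) ∪
  -- S₁ : block (5,7), Φ'(c) = ∅
  {toLoc k m (genMat (2*(k+m)+5) (i5 k m) (i7 k m))} ∪
  -- S₁ : block (5,9), Φ'(c) = {(7,8)}
  (Set.range fun b : Fin m =>
    - Ring.inverse (toLoc k m (genMat (2*(k+m)+5) (i7 k m) (i8 k m)))
      * toLoc k m ((genMat (2*(k+m)+5)).submatrix
          ![i5 k m, i7 k m] ![i8 k m, c9 k m b]).det) ∪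
  -- S₁ : block (6,7), Φ'(c) = ∅
  (Set.range fun a : Fin k => toLoc k m (genMat (2*(k+m)+5) (c6 k m a) (i7 k m))) ∪
  -- S₁ : block (6,9), Φ'(c) = {(7,8)}
  (Set.range fun p : Fin k × Fin m =>
    - Ring.inverse (toLoc k m (genMat (2*(k+m)+5) (i7 k m) (i8 k m)))
      * toLoc k m ((genMat (2*(k+m)+5)).submatrix
          ![c6 k m p.1, i7 k m] ![i8 k m, c9 k m p.2]).det) ∪
  -- S₁ : block (8,9), Φ'(c) = ∅
  (Set.range fun b : Fin m => toLoc k m (genMat (2*(k+m)+5) (i8 k m) (c9 k m b))) ∪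
  -- S₂ : entries of C₂₃C₃₆ + C₂₄C₄₆
  (Set.range fun b : Fin k => toLoc k m
    (genMat (2*(k+m)+5) (i2 k m) (i3 k m) * genMat (2*(k+m)+5) (i3 k m) (c6 k m b)
      + ∑ t : Fin k,
          genMat (2*(k+m)+5) (i2 k m) (r4 k m t) * genMat (2*(k+m)+5) (r4 k m t) (c6 k m b))) ∪
  -- S₂ : entries of C₄₆C₆₈ + C₄₇C₇₈
  (Set.range fun a : Fin k => toLoc k m
    ((∑ t : Fin k,
        genMat (2*(k+m)+5) (r4 k m a) (c6 k m t) * genMat (2*(k+m)+5) (c6 k m t) (i8 k m))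
      + genMat (2*(k+m)+5) (r4 k m a) (i7 k m) * genMat (2*(k+m)+5) (i7 k m) (i8 k m))) ∪
  -- S₂ : γ₁C₂₃ − γ₂C₇₈
  {toLoc k m (MvPolynomial.C γ₁ * genMat (2*(k+m)+5) (i2 k m) (i3 k m)
      - MvPolynomial.C γ₂ * genMat (2*(k+m)+5) (i7 k m) (i8 k m))}

end Indices

/-! ### Determinants of bordered matrices -/

section Bordered

variable {ι A : Type*} [CommRing A]

/-- If the last column of a bordered matrix is, away from the first row, a combination of the
other columns, then its determinant is the resulting defect in the corner times the minor. -/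
theorem det_bordered_of_col {N : ℕ} (g : Matrix ι ι A) (i₀ j₀ : ι) (ρ κ : Fin N → ι)
    (v : Fin N → A) (h : ∀ s, g (ρ s) j₀ = ∑ t, g (ρ s) (κ t) * v t) :
    (g.submatrix (Fin.cons i₀ ρ : Fin (N + 1) → ι) (Fin.snoc κ j₀ : Fin (N + 1) → ι)).det
      = (-1) ^ N * (g i₀ j₀ - ∑ t, g i₀ (κ t) * v t) * (g.submatrix ρ κ).det := by
  set M := g.submatrix (Fin.cons i₀ ρ : Fin (N + 1) → ι) (Fin.snoc κ j₀ : Fin (N + 1) → ι)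
  set x : Fin (N + 1) → A := Fin.snoc (fun t => - v t) 1 with hx
  have h1 : M *ᵥ x = Pi.single 0 (g i₀ j₀ - ∑ t, g i₀ (κ t) * v t) := by
    funext s
    refine Fin.cases ?_ (fun s => ?_) s
    · simp [M, x, Matrix.mulVec, dotProduct, Fin.sum_univ_castSucc]
      ring
    · simp [M, x, Matrix.mulVec, dotProduct, Fin.sum_univ_castSucc, h]
  have h2 : M.adjugate *ᵥ (M *ᵥ x) = M.det • x := by
    rw [Matrix.mulVec_mulVec, Matrix.adjugate_mul, Matrix.smul_mulVec, Matrix.one_mulVec]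
  have h3 := congrFun h2 (Fin.last N)
  rw [h1] at h3
  have h4 : M.submatrix Fin.succ Fin.castSucc = g.submatrix ρ κ := by
    ext a b
    simp [M]
  simp only [Matrix.mulVec_single, Pi.smul_apply, hx, Fin.snoc_last, smul_eq_mul, mul_one,
    Matrix.col_apply, Matrix.adjugate_fin_succ_eq_det_submatrix, Fin.succAbove_zero,
    Fin.succAbove_last, h4, MulOpposite.smul_eq_mul_unop, MulOpposite.unop_op] at h3
  rw [← h3]
  simp
  ring

/-- If the first row of a bordered matrix is, away from the last column, a combination of the
other rows, then its determinant is the resulting defect in the corner times the minor. -/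
theorem det_bordered_of_row {N : ℕ} (g : Matrix ι ι A) (i₀ j₀ : ι) (ρ κ : Fin N → ι)
    (v : Fin N → A) (h : ∀ t, g i₀ (κ t) = ∑ s, v s * g (ρ s) (κ t)) :
    (g.submatrix (Fin.cons i₀ ρ : Fin (N + 1) → ι) (Fin.snoc κ j₀ : Fin (N + 1) → ι)).det
      = (-1) ^ N * (g i₀ j₀ - ∑ s, v s * g (ρ s) j₀) * (g.submatrix ρ κ).det := by
  set M := g.submatrix (Fin.cons i₀ ρ : Fin (N + 1) → ι) (Fin.snoc κ j₀ : Fin (N + 1) → ι)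
  set x : Fin (N + 1) → A := Fin.cons 1 (fun t => - v t) with hx
  have h1 : x ᵥ* M = Pi.single (Fin.last N) (g i₀ j₀ - ∑ s, v s * g (ρ s) j₀) := by
    funext s
    refine Fin.lastCases ?_ (fun s => ?_) s
    · simp [M, x, Matrix.vecMul, dotProduct, Fin.sum_univ_succ]
      ring
    · simp [M, x, Matrix.vecMul, dotProduct, Fin.sum_univ_succ, h]
  have h2 : (x ᵥ* M) ᵥ* M.adjugate = M.det • x := by
    rw [Matrix.vecMul_vecMul, Matrix.mul_adjugate, Matrix.vecMul_smul, Matrix.vecMul_one]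
  have h3 := congrFun h2 0
  rw [h1] at h3
  have h4 : M.submatrix Fin.succ Fin.castSucc = g.submatrix ρ κ := by
    ext a b
    simp [M]
  simp only [Matrix.single_vecMul, Pi.smul_apply, hx, Fin.cons_zero, smul_eq_mul, mul_one,
    Matrix.row_apply, Matrix.adjugate_fin_succ_eq_det_submatrix, Fin.succAbove_zero,
    Fin.succAbove_last, h4] at h3
  rw [← h3]
  simp
  ring

theorem det_submatrix_cons_cons {N : ℕ} (g : Matrix ι ι A) (i j : ι) (ρ κ : Fin N → ι)
    (h : ∀ s, g (ρ s) j = 0) :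
    (g.submatrix (Fin.cons i ρ : Fin (N + 1) → ι) (Fin.cons j κ : Fin (N + 1) → ι)).det
      = g i j * (g.submatrix ρ κ).det := by
  rw [Matrix.det_succ_column_zero, Fin.sum_univ_succ]
  simp [h]

theorem det_submatrix_snoc_snoc {N : ℕ} (g : Matrix ι ι A) (i j : ι) (ρ κ : Fin N → ι)
    (h : ∀ t, g i (κ t) = 0) :
    (g.submatrix (Fin.snoc ρ i : Fin (N + 1) → ι) (Fin.snoc κ j : Fin (N + 1) → ι)).det
      = (g.submatrix ρ κ).det * g i j := by
  rw [Matrix.det_succ_row _ (Fin.last N), Fin.sum_univ_castSucc]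
  simp [h, ← two_mul]
  rw [mul_comm]

end Bordered

/-! ### Blocks of indices -/

/-- The nine blocks of the partition. -/
inductive Blk
  | b1 | b2 | b3 | b4 | b5 | b6 | b7 | b8 | b9

open Blk

/-- The position of a block in the partition. -/
def Blk.num : Blk → ℕ
  | b1 => 1 | b2 => 2 | b3 => 3 | b4 => 4 | b5 => 5 | b6 => 6 | b7 => 7 | b8 => 8 | b9 => 9

section Elimination

variable {k m : ℕ}

/-- The block containing a given index. -/
def blk (i : Fin (2*(k+m)+5)) : Blk :=
  if i.val < m then b1 else if i.val < m + 1 then b2 else if i.val < m + 2 then b3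
  else if i.val < m + k + 2 then b4 else if i.val < m + k + 3 then b5
  else if i.val < m + 2*k + 3 then b6 else if i.val < m + 2*k + 4 then b7
  else if i.val < m + 2*k + 5 then b8 else b9

theorem blk_r1 (a : Fin m) : blk (r1 k m a) = b1 := by
  simp [blk, r1]

theorem blk_i2 : blk (i2 k m) = b2 := by
  simp [blk, i2]

theorem blk_i3 : blk (i3 k m) = b3 := by
  simp [blk, i3]

theorem blk_r4 (a : Fin k) : blk (r4 k m a) = b4 := by
  have := a.isLt
  unfold blk r4
  dsimp only
  repeat (first | rw [if_neg (by omega)] | rw [if_pos (by omega)])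

theorem blk_i5 : blk (i5 k m) = b5 := by
  unfold blk i5
  dsimp only
  repeat (first | rw [if_neg (by omega)] | rw [if_pos (by omega)])

theorem blk_c6 (a : Fin k) : blk (c6 k m a) = b6 := by
  have := a.isLt
  unfold blk c6
  dsimp only
  repeat (first | rw [if_neg (by omega)] | rw [if_pos (by omega)])

theorem blk_i7 : blk (i7 k m) = b7 := by
  unfold blk i7
  dsimp only
  repeat (first | rw [if_neg (by omega)] | rw [if_pos (by omega)])

theorem blk_i8 : blk (i8 k m) = b8 := by
  unfold blk i8
  dsimp only
  repeat (first | rw [if_neg (by omega)] | rw [if_pos (by omega)])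

theorem blk_c9 (a : Fin m) : blk (c9 k m a) = b9 := by
  have := a.isLt
  unfold blk c9
  dsimp only
  repeat rw [if_neg (by omega)]

theorem index_cases (i : Fin (2*(k+m)+5)) :
    (∃ a, i = r1 k m a) ∨ i = i2 k m ∨ i = i3 k m ∨ (∃ a, i = r4 k m a) ∨ i = i5 k m ∨
      (∃ a, i = c6 k m a) ∨ i = i7 k m ∨ i = i8 k m ∨ (∃ a, i = c9 k m a) := by
  have hi := i.isLt
  by_cases h1 : i.val < m
  · exact .inl ⟨⟨i, h1⟩, rfl⟩
  refine .inr ?_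
  by_cases h2 : i.val = m
  · exact .inl (Fin.ext h2)
  refine .inr ?_
  by_cases h3 : i.val = m + 1
  · exact .inl (Fin.ext h3)
  refine .inr ?_
  by_cases h4 : i.val < m + k + 2
  · exact .inl ⟨⟨i - (m + 2), by omega⟩, Fin.ext (by simp only [r4]; omega)⟩
  refine .inr ?_
  by_cases h5 : i.val = m + k + 2
  · exact .inl (Fin.ext h5)
  refine .inr ?_
  by_cases h6 : i.val < m + 2*k + 3
  · exact .inl ⟨⟨i - (m + k + 3), by omega⟩, Fin.ext (by simp only [c6]; omega)⟩
  refine .inr ?_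
  by_cases h7 : i.val = m + 2*k + 3
  · exact .inl (Fin.ext h7)
  refine .inr ?_
  by_cases h8 : i.val = m + 2*k + 4
  · exact .inl (Fin.ext h8)
  exact .inr ⟨⟨i - (m + 2*k + 5), by omega⟩, Fin.ext (by simp only [c9]; omega)⟩

theorem lt_of_num_blk_lt {i j : Fin (2*(k+m)+5)} (h : (blk i).num < (blk j).num) : i < j := by
  have key : ∀ l : Fin (2*(k+m)+5), ((blk l).num = 1 ∧ l.val < m) ∨ ((blk l).num = 2 ∧ l.val = m) ∨
      ((blk l).num = 3 ∧ l.val = m + 1) ∨ ((blk l).num = 4 ∧ m + 1 < l.val ∧ l.val < m + k + 2) ∨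
      ((blk l).num = 5 ∧ l.val = m + k + 2) ∨
      ((blk l).num = 6 ∧ m + k + 2 < l.val ∧ l.val < m + 2*k + 3) ∨
      ((blk l).num = 7 ∧ l.val = m + 2*k + 3) ∨ ((blk l).num = 8 ∧ l.val = m + 2*k + 4) ∨
      ((blk l).num = 9 ∧ m + 2*k + 4 < l.val) := by
    intro l
    unfold blk
    split_ifs <;> simp [Blk.num] <;> omega
  have hi := key i
  have hj := key j
  rw [Fin.lt_def]
  omega

theorem r1_lt_iff {a b : Fin m} : r1 k m a < r1 k m b ↔ a < b := Iff.rfl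

theorem r4_lt_iff {a b : Fin k} : r4 k m a < r4 k m b ↔ a < b := by
  simp only [Fin.lt_def, r4]
  omega

theorem c6_lt_iff {a b : Fin k} : c6 k m a < c6 k m b ↔ a < b := by
  simp only [Fin.lt_def, c6]
  omega

theorem c9_lt_iff {a b : Fin m} : c9 k m a < c9 k m b ↔ a < b := by
  simp only [Fin.lt_def, c9]
  omega

theorem num_blk_le_of_lt {i j : Fin (2*(k+m)+5)} (h : i < j) : (blk i).num ≤ (blk j).num := by
  by_contra hij
  exact absurd (lt_of_num_blk_lt (not_le.mp hij)) h.asymm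

/-! ### The equations equivalent to the vanishing of `S` -/

variable {A : Type*} [CommRing A]

/-- The equations on the blocks of `g` expressing the eliminated entries through the others.
Here `w` is the inverse of `C₇₈`, and `c * w⁻¹`, `c' * w` are `C₂₃` and its inverse. -/
structure ElimRel (g : Matrix (Fin (2*(k+m)+5)) (Fin (2*(k+m)+5)) A) (c c' w : A) : Prop where
  h11 : ∀ a b, a < b → g (r1 k m a) (r1 k m b) = 0
  h44 : ∀ a b, a < b → g (r4 k m a) (r4 k m b) = 0
  h66 : ∀ a b, a < b → g (c6 k m a) (c6 k m b) = 0
  h99 : ∀ a b, a < b → g (c9 k m a) (c9 k m b) = 0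
  h12 : ∀ a, g (r1 k m a) (i2 k m) = 0
  h14 : ∀ a b, g (r1 k m a) (r4 k m b) = c' * w * g (r1 k m a) (i3 k m) * g (i2 k m) (r4 k m b)
  h15 : ∀ a, g (r1 k m a) (i5 k m) = c' * w * g (r1 k m a) (i3 k m) * g (i2 k m) (i5 k m)
  h17 : ∀ a, g (r1 k m a) (i7 k m) = g (r1 k m a) (i3 k m) * (c' * w * (g (i2 k m) (i7 k m)
      - ∑ t, g (i2 k m) (c6 k m t) * -(w * g (c6 k m t) (i8 k m))))
      + ∑ t, g (r1 k m a) (c6 k m t) * -(w * g (c6 k m t) (i8 k m))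
  h23 : g (i2 k m) (i3 k m) = c * g (i7 k m) (i8 k m)
  h34 : ∀ b, g (i3 k m) (r4 k m b) = 0
  h35 : g (i3 k m) (i5 k m) = 0
  h36 : ∀ b, g (i3 k m) (c6 k m b)
      = ∑ s, -(c' * w * g (i2 k m) (r4 k m s)) * g (r4 k m s) (c6 k m b)
  h37 : g (i3 k m) (i7 k m) = ∑ s, -(c' * w * g (i2 k m) (r4 k m s)) * g (r4 k m s) (i7 k m)
  h39 : ∀ b, g (i3 k m) (c9 k m b)
      = ∑ s, -(c' * w * g (i2 k m) (r4 k m s)) * g (r4 k m s) (c9 k m b)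
        + w * (g (i3 k m) (i8 k m) - ∑ s, -(c' * w * g (i2 k m) (r4 k m s)) * g (r4 k m s) (i8 k m))
          * g (i7 k m) (c9 k m b)
  h45 : ∀ a, g (r4 k m a) (i5 k m) = 0
  h47 : ∀ a, g (r4 k m a) (i7 k m)
      = ∑ t, g (r4 k m a) (c6 k m t) * -(w * g (c6 k m t) (i8 k m))
  h56 : ∀ b, g (i5 k m) (c6 k m b) = 0
  h57 : g (i5 k m) (i7 k m) = 0
  h59 : ∀ b, g (i5 k m) (c9 k m b) = w * g (i5 k m) (i8 k m) * g (i7 k m) (c9 k m b)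
  h67 : ∀ a, g (c6 k m a) (i7 k m) = 0
  h69 : ∀ a b, g (c6 k m a) (c9 k m b) = w * g (c6 k m a) (i8 k m) * g (i7 k m) (c9 k m b)
  h89 : ∀ b, g (i8 k m) (c9 k m b) = 0

/-- The expression of an above-diagonal entry through the entries that are not eliminated. -/
def elimEntry (g : Matrix (Fin (2*(k+m)+5)) (Fin (2*(k+m)+5)) A) (c c' w : A)
    (i j : Fin (2*(k+m)+5)) : A :=
  match blk i, blk j with
  | b1, b1 | b4, b4 | b6, b6 | b9, b9 | b1, b2 | b3, b4 | b3, b5 | b4, b5 | b5, b6 | b5, b7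
  | b6, b7 | b8, b9 => 0
  | b1, b4 | b1, b5 => c' * w * g i (i3 k m) * g (i2 k m) j
  | b1, b7 => g i (i3 k m) * (c' * w * (g (i2 k m) j
      - ∑ t, g (i2 k m) (c6 k m t) * -(w * g (c6 k m t) (i8 k m))))
      + ∑ t, g i (c6 k m t) * -(w * g (c6 k m t) (i8 k m))
  | b2, b3 => c * g (i7 k m) (i8 k m)
  | b3, b6 => ∑ s, -(c' * w * g (i2 k m) (r4 k m s)) * g (r4 k m s) j
  | b3, b7 => ∑ s, -(c' * w * g (i2 k m) (r4 k m s))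
      * ∑ t, g (r4 k m s) (c6 k m t) * -(w * g (c6 k m t) (i8 k m))
  | b3, b9 => ∑ s, -(c' * w * g (i2 k m) (r4 k m s)) * g (r4 k m s) j
      + w * (g i (i8 k m) - ∑ s, -(c' * w * g (i2 k m) (r4 k m s)) * g (r4 k m s) (i8 k m))
        * g (i7 k m) j
  | b4, b7 => ∑ t, g i (c6 k m t) * -(w * g (c6 k m t) (i8 k m))
  | b5, b9 | b6, b9 => w * g i (i8 k m) * g (i7 k m) j
  | _, _ => g i j

theorem map_elimEntry {B : Type*} [CommRing B] (f : A →+* B)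
    (g : Matrix (Fin (2*(k+m)+5)) (Fin (2*(k+m)+5)) A) (c c' w : A) (i j : Fin (2*(k+m)+5)) :
    f (elimEntry g c c' w i j) = elimEntry (g.map f) (f c) (f c') (f w) i j := by
  unfold elimEntry
  cases blk i <;> cases blk j <;> simp

theorem ElimRel.eq_elimEntry {g : Matrix (Fin (2*(k+m)+5)) (Fin (2*(k+m)+5)) A} {c c' w : A}
    (h : ElimRel g c c' w) {i j : Fin (2*(k+m)+5)} (hij : i < j) :
    g i j = elimEntry g c c' w i j := by
  have hle := num_blk_le_of_lt hij
  rcases index_cases i with ⟨a, rfl⟩ | rfl | rfl | ⟨a, rfl⟩ | rfl | ⟨a, rfl⟩ | rfl | rfl | ⟨a, rfl⟩ <;>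
  rcases index_cases j with ⟨b, rfl⟩ | rfl | rfl | ⟨b, rfl⟩ | rfl | ⟨b, rfl⟩ | rfl | rfl | ⟨b, rfl⟩ <;>
  simp only [blk_r1, blk_i2, blk_i3, blk_r4, blk_i5, blk_c6, blk_i7, blk_i8, blk_c9, Blk.num,
    Nat.reduceLeDiff] at hle <;>
  simp only [elimEntry, blk_r1, blk_i2, blk_i3, blk_r4, blk_i5, blk_c6, blk_i7, blk_i8, blk_c9]
  · exact h.h11 _ _ (r1_lt_iff.mp hij)
  · exact h.h12 _
  · exact h.h14 _ _
  · exact h.h15 _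
  · exact h.h17 _
  · exact h.h23
  · exact h.h34 _
  · exact h.h35
  · exact h.h36 _
  · simp only [h.h37, h.h47]
  · exact h.h39 _
  · exact h.h44 _ _ (r4_lt_iff.mp hij)
  · exact h.h45 _
  · exact h.h47 _
  · exact h.h56 _
  · exact h.h57
  · exact h.h59 _
  · exact h.h66 _ _ (c6_lt_iff.mp hij)
  · exact h.h67 _
  · exact h.h69 _ _
  · exact h.h89 _
  · exact h.h99 _ _ (c9_lt_iff.mp hij)

theorem ElimRel.of_eq_elimEntry {g G : Matrix (Fin (2*(k+m)+5)) (Fin (2*(k+m)+5)) A} {c c' w : A}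
    (h : ∀ i j, i < j → G i j = elimEntry g c c' w i j) : ElimRel G c c' w := by
  have h' : ∀ i j, (blk i).num < (blk j).num → G i j = elimEntry g c c' w i j :=
    fun i j hij => h i j (lt_of_num_blk_lt hij)
  constructor
  case h11 =>
    intro a b hab
    rw [h _ _ (r1_lt_iff.mpr hab)]
    simp [elimEntry, blk_r1]
  case h44 =>
    intro a b hab
    rw [h _ _ (r4_lt_iff.mpr hab)]
    simp [elimEntry, blk_r4]
  case h66 =>
    intro a b hab
    rw [h _ _ (c6_lt_iff.mpr hab)]
    simp [elimEntry, blk_c6]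
  case h99 =>
    intro a b hab
    rw [h _ _ (c9_lt_iff.mpr hab)]
    simp [elimEntry, blk_c9]
  all_goals
    simp [h', elimEntry, Blk.num, blk_r1, blk_i2, blk_i3, blk_r4, blk_i5, blk_c6, blk_i7, blk_i8,
      blk_c9]

end Elimination

/-! ### The localization -/

theorem genMat_apply_lt {n : ℕ} {i j : Fin n} (h : i < j) :
    genMat n i j = MvPolynomial.X ⟨(i, j), h⟩ := by
  simp [genMat, h]

theorem genMat_apply_gt {n : ℕ} {i j : Fin n} (h : j < i) : genMat n i j = 0 := by
  simp [genMat, h.asymm, h.ne']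

theorem genMat_apply_lt_ne_zero {n : ℕ} {i j : Fin n} (h : i < j) : genMat n i j ≠ 0 := by
  rw [genMat_apply_lt h]
  exact MvPolynomial.X_ne_zero _

section Localized

variable {k m : ℕ}

theorem i2_lt_i3 : i2 k m < i3 k m := by simp [Fin.lt_def, i2, i3]

theorem i7_lt_i8 : i7 k m < i8 k m := by simp [Fin.lt_def, i7, i8]

theorem i3_lt_r4 (a : Fin k) : i3 k m < r4 k m a := by
  simp only [Fin.lt_def, i3, r4]
  omega

theorem r4_lt_c6 (a b : Fin k) : r4 k m a < c6 k m b := by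
  simp only [Fin.lt_def, r4, c6]
  omega

theorem c6_lt_i7 (a : Fin k) : c6 k m a < i7 k m := by
  simp only [Fin.lt_def, c6, i7]
  omega

theorem det_genMat_ne_zero :
    ((genMat (2*(k+m)+5)).submatrix (r4 k m) (c6 k m)).det ≠ 0 := by
  intro h
  have h1 := congrArg (MvPolynomial.eval
    (fun p : {p : Fin (2*(k+m)+5) × Fin (2*(k+m)+5) // p.1 < p.2} =>
      if p.1.2.val = p.1.1.val + (k + 1) then (1 : ℝ) else 0)) h
  rw [RingHom.map_det, map_zero] at h1
  have h2 : (MvPolynomial.eval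
    (fun p : {p : Fin (2*(k+m)+5) × Fin (2*(k+m)+5) // p.1 < p.2} =>
      if p.1.2.val = p.1.1.val + (k + 1) then (1 : ℝ) else 0)).mapMatrix
      ((genMat (2*(k+m)+5)).submatrix (r4 k m) (c6 k m)) = 1 := by
    ext a b
    rw [RingHom.mapMatrix_apply, Matrix.map_apply, Matrix.submatrix_apply,
      genMat_apply_lt (r4_lt_c6 a b), MvPolynomial.eval_X, Matrix.one_apply]
    refine if_congr ?_ rfl rfl
    simp only [r4, c6, Fin.ext_iff]
    omega
  rw [h2, Matrix.det_one] at h1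
  exact one_ne_zero h1

theorem dPoly_ne_zero : dPoly k m ≠ 0 :=
  mul_ne_zero (mul_ne_zero (genMat_apply_lt_ne_zero i2_lt_i3) det_genMat_ne_zero)
    (genMat_apply_lt_ne_zero i7_lt_i8)

instance isDomain_locRing : IsDomain (LocRing k m) :=
  IsLocalization.isDomain_localization
    (powers_le_nonZeroDivisors_of_noZeroDivisors dPoly_ne_zero)

theorem isUnit_toLoc_of_dvd {x : CoordRing (2*(k+m)+5)} (h : x ∣ dPoly k m) :
    IsUnit (toLoc k m x) :=
  isUnit_of_dvd_unit (map_dvd (toLoc k m) h) (IsLocalization.Away.algebraMap_isUnit _)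

theorem map_neg_inverse_mul_eq_zero_iff {B A : Type*} [CommRing B] [CommRing A] (f : B →+* A)
    {x : B} (hx : IsUnit x) (y : B) : f (-Ring.inverse x * y) = 0 ↔ f y = 0 := by
  rw [map_mul, map_neg]
  exact (hx.ringInverse.map f).neg.mul_right_eq_zero

theorem map_pow_mul_inverse_mul_eq_zero_iff {B A : Type*} [CommRing B] [CommRing A] (f : B →+* A)
    {x : B} (hx : IsUnit x) (N : ℕ) (y : B) :
    f ((-1) ^ N * Ring.inverse x * y) = 0 ↔ f y = 0 := by
  rw [map_mul]
  exact (((isUnit_neg_one.pow N).mul hx.ringInverse).map f).mul_right_eq_zero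

theorem pow_mul_sub_mul_eq_zero_iff {A : Type*} [CommRing A] {x y z : A} (hz : IsUnit z) (N : ℕ) :
    (-1) ^ N * (x - y) * z = 0 ↔ x = y := by
  rw [hz.mul_left_eq_zero, (isUnit_neg_one.pow N).mul_right_eq_zero, sub_eq_zero]

theorem mul_sub_mul_eq_zero_iff {A : Type*} [CommRing A] {u x y z q : A} (hu : u * q = 1) :
    x * y - z * q = 0 ↔ z = u * x * y := by
  constructor <;> intro h
  · linear_combination (-u) * h - z * hu
  · linear_combination (-q) * h - x * y * hu

variable {A : Type*} [CommRing A] {γ₁ γ₂ : ℝ}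

/-- A homomorphism out of the localization kills `S` exactly when the images of the matrix
entries satisfy the elimination equations. -/
theorem forall_map_SPoly_eq_zero_iff (hγ₁ : γ₁ ≠ 0) (hγ₂ : γ₂ ≠ 0) (f : LocRing k m →+* A)
    {w : A} (hw : w * f (toLoc k m (genMat _ (i7 k m) (i8 k m))) = 1) :
    (∀ s ∈ SPoly k m γ₁ γ₂, f s = 0) ↔
      ElimRel ((genMat (2*(k+m)+5)).map (f.comp (toLoc k m)))
        (f (toLoc k m (MvPolynomial.C (γ₂ / γ₁)))) (f (toLoc k m (MvPolynomial.C (γ₁ / γ₂)))) w := by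
  set g := (genMat (2*(k+m)+5)).map (f.comp (toLoc k m))
  set c := f (toLoc k m (MvPolynomial.C (γ₂ / γ₁)))
  set c' := f (toLoc k m (MvPolynomial.C (γ₁ / γ₂)))
  have hgen : ∀ i j, f (toLoc k m (genMat (2*(k+m)+5) i j)) = g i j := fun _ _ => rfl
  have hdet : ∀ {N : ℕ} (ρ κ : Fin N → Fin (2*(k+m)+5)),
      f (toLoc k m ((genMat (2*(k+m)+5)).submatrix ρ κ).det) = (g.submatrix ρ κ).det := by
    intro N ρ κ
    exact RingHom.map_det (f.comp (toLoc k m)) _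
  have hc'c : c' * c = 1 := by
    simp only [c, c', ← map_mul]
    rw [show γ₁ / γ₂ * (γ₂ / γ₁) = 1 by field_simp]
    simp
  have hc : ∀ x y : CoordRing (2*(k+m)+5),
      f (toLoc k m (MvPolynomial.C γ₁ * x - MvPolynomial.C γ₂ * y)) = 0 ↔
        f (toLoc k m x) = c * f (toLoc k m y) := by
    intro x y
    have hu : IsUnit (f (toLoc k m (MvPolynomial.C γ₁))) :=
      (((IsUnit.mk0 γ₁ hγ₁).map MvPolynomial.C).map (toLoc k m)).map f
    have h1 : f (toLoc k m (MvPolynomial.C γ₂)) = f (toLoc k m (MvPolynomial.C γ₁)) * c := by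
      simp only [c, ← map_mul]
      rw [mul_div_cancel₀ _ hγ₁]
    rw [map_sub, map_sub, map_mul, map_mul, map_mul, map_mul, h1, mul_assoc, ← mul_sub,
      hu.mul_right_eq_zero, sub_eq_zero]
  rw [hgen] at hw
  have hd23 : genMat (2*(k+m)+5) (i2 k m) (i3 k m) ∣ dPoly k m :=
    ⟨_, mul_assoc _ _ _⟩
  have hd78 : genMat (2*(k+m)+5) (i7 k m) (i8 k m) ∣ dPoly k m := Dvd.intro_left _ rfl
  have hd46 : ((genMat (2*(k+m)+5)).submatrix (r4 k m) (c6 k m)).det ∣ dPoly k m :=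
    (Dvd.intro_left _ rfl).mul_right _
  have hd2346 : ((genMat (2*(k+m)+5)).submatrix
      (Fin.cons (i2 k m) (r4 k m) : Fin (k + 1) → _) (Fin.cons (i3 k m) (c6 k m))).det
      ∣ dPoly k m := by
    rw [det_submatrix_cons_cons _ _ _ _ _ fun s => genMat_apply_gt (i3_lt_r4 s)]
    exact Dvd.intro _ rfl
  have hd4678 : ((genMat (2*(k+m)+5)).submatrix
      (Fin.snoc (r4 k m) (i7 k m) : Fin (k + 1) → _) (Fin.snoc (c6 k m) (i8 k m))).det
      ∣ dPoly k m := by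
    rw [det_submatrix_snoc_snoc _ _ _ _ _ fun s => genMat_apply_gt (c6_lt_i7 s)]
    exact ⟨genMat _ (i2 k m) (i3 k m), by rw [dPoly]; ring⟩
  have hU46 : IsUnit (g.submatrix (r4 k m) (c6 k m)).det := by
    rw [← hdet]
    exact (isUnit_toLoc_of_dvd hd46).map f
  have hU2346 : IsUnit (g.submatrix
      (Fin.cons (i2 k m) (r4 k m) : Fin (k + 1) → _) (Fin.cons (i3 k m) (c6 k m))).det := by
    rw [← hdet]
    exact (isUnit_toLoc_of_dvd hd2346).map f
  have hU4678 : IsUnit (g.submatrix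
      (Fin.snoc (r4 k m) (i7 k m) : Fin (k + 1) → _) (Fin.snoc (c6 k m) (i8 k m))).det := by
    rw [← hdet]
    exact (isUnit_toLoc_of_dvd hd4678).map f
  have hg43 : ∀ s, g (r4 k m s) (i3 k m) = 0 := fun s => by
    rw [← hgen, genMat_apply_gt (i3_lt_r4 s), map_zero, map_zero]
  have hg76 : ∀ t, g (i7 k m) (c6 k m t) = 0 := fun t => by
    rw [← hgen, genMat_apply_gt (c6_lt_i7 t), map_zero, map_zero]
  have hu23 : g (i2 k m) (i3 k m) = c * g (i7 k m) (i8 k m) →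
      c' * w * g (i2 k m) (i3 k m) = 1 := by
    intro h
    rw [h]
    linear_combination c' * c * hw + hc'c
  have hS36 : g (i2 k m) (i3 k m) = c * g (i7 k m) (i8 k m) → ∀ b,
      (g (i2 k m) (i3 k m) * g (i3 k m) (c6 k m b)
        + ∑ t, g (i2 k m) (r4 k m t) * g (r4 k m t) (c6 k m b) = 0 ↔
      g (i3 k m) (c6 k m b)
        = ∑ s, -(c' * w * g (i2 k m) (r4 k m s)) * g (r4 k m s) (c6 k m b)) := by
    intro h b
    have hu := hu23 h
    have h1 : ∑ s, -(c' * w * g (i2 k m) (r4 k m s)) * g (r4 k m s) (c6 k m b)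
        = -(c' * w) * ∑ t, g (i2 k m) (r4 k m t) * g (r4 k m t) (c6 k m b) := by
      rw [Finset.mul_sum]
      exact Finset.sum_congr rfl fun _ _ => by ring
    rw [h1]
    constructor <;> intro h2
    · linear_combination c' * w * h2 - g (i3 k m) (c6 k m b) * hu
    · linear_combination g (i2 k m) (i3 k m) * h2
        - (∑ t, g (i2 k m) (r4 k m t) * g (r4 k m t) (c6 k m b)) * hu
  have hS47 : ∀ a, (∑ t, g (r4 k m a) (c6 k m t) * g (c6 k m t) (i8 k m))
        + g (r4 k m a) (i7 k m) * g (i7 k m) (i8 k m) = 0 ↔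
      g (r4 k m a) (i7 k m)
        = ∑ t, g (r4 k m a) (c6 k m t) * -(w * g (c6 k m t) (i8 k m)) := by
    intro a
    have h1 : ∑ t, g (r4 k m a) (c6 k m t) * -(w * g (c6 k m t) (i8 k m))
        = -w * ∑ t, g (r4 k m a) (c6 k m t) * g (c6 k m t) (i8 k m) := by
      rw [Finset.mul_sum]
      exact Finset.sum_congr rfl fun _ _ => by ring
    rw [h1]
    constructor <;> intro h2
    · linear_combination w * h2 - g (r4 k m a) (i7 k m) * hw
    · linear_combination g (i7 k m) (i8 k m) * h2
        - (∑ t, g (r4 k m a) (c6 k m t) * g (c6 k m t) (i8 k m)) * hw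
  have hD17 : g (i2 k m) (i3 k m) = c * g (i7 k m) (i8 k m) → (∀ a, g (r4 k m a) (i7 k m)
        = ∑ t, g (r4 k m a) (c6 k m t) * -(w * g (c6 k m t) (i8 k m))) → ∀ a,
      ((g.submatrix (Fin.cons (r1 k m a) (Fin.cons (i2 k m) (r4 k m)) : Fin (k + 2) → _)
          (Fin.snoc (Fin.cons (i3 k m) (c6 k m) : Fin (k + 1) → _) (i7 k m))).det = 0 ↔
        g (r1 k m a) (i7 k m) = g (r1 k m a) (i3 k m) * (c' * w * (g (i2 k m) (i7 k m)
          - ∑ t, g (i2 k m) (c6 k m t) * -(w * g (c6 k m t) (i8 k m))))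
          + ∑ t, g (r1 k m a) (c6 k m t) * -(w * g (c6 k m t) (i8 k m))) := by
    intro h h47 a
    have hu := hu23 h
    rw [det_bordered_of_col g _ _ _ _ (Fin.cons (c' * w * (g (i2 k m) (i7 k m)
          - ∑ t, g (i2 k m) (c6 k m t) * -(w * g (c6 k m t) (i8 k m))))
          fun t => -(w * g (c6 k m t) (i8 k m))) ?_, pow_mul_sub_mul_eq_zero_iff hU2346,
          Fin.sum_univ_succ]
    · simp only [Fin.cons_zero, Fin.cons_succ]
    · intro s
      rw [Fin.sum_univ_succ]
      refine Fin.cases ?_ (fun s => ?_) s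
      · simp only [Fin.cons_zero, Fin.cons_succ]
        linear_combination (-(g (i2 k m) (i7 k m))
          + ∑ t, g (i2 k m) (c6 k m t) * -(w * g (c6 k m t) (i8 k m))) * hu
      · simp only [Fin.cons_zero, Fin.cons_succ, hg43, zero_mul, zero_add, h47]
  have hD37 : (∀ b, g (i3 k m) (c6 k m b)
        = ∑ s, -(c' * w * g (i2 k m) (r4 k m s)) * g (r4 k m s) (c6 k m b)) →
      ((g.submatrix (Fin.cons (i3 k m) (r4 k m) : Fin (k + 1) → _)
          (Fin.snoc (c6 k m) (i7 k m))).det = 0 ↔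
        g (i3 k m) (i7 k m)
          = ∑ s, -(c' * w * g (i2 k m) (r4 k m s)) * g (r4 k m s) (i7 k m)) := by
    intro h36
    rw [det_bordered_of_row g _ _ _ _ _ h36, pow_mul_sub_mul_eq_zero_iff hU46]
  have hD39 : (∀ b, g (i3 k m) (c6 k m b)
        = ∑ s, -(c' * w * g (i2 k m) (r4 k m s)) * g (r4 k m s) (c6 k m b)) → ∀ b,
      ((g.submatrix (Fin.cons (i3 k m) (Fin.snoc (r4 k m) (i7 k m) : Fin (k + 1) → _))
          (Fin.snoc (Fin.snoc (c6 k m) (i8 k m) : Fin (k + 1) → _) (c9 k m b))).det = 0 ↔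
        g (i3 k m) (c9 k m b)
          = ∑ s, -(c' * w * g (i2 k m) (r4 k m s)) * g (r4 k m s) (c9 k m b)
          + w * (g (i3 k m) (i8 k m)
            - ∑ s, -(c' * w * g (i2 k m) (r4 k m s)) * g (r4 k m s) (i8 k m))
            * g (i7 k m) (c9 k m b)) := by
    intro h36 b
    rw [det_bordered_of_row g _ _ _ _ (Fin.snoc (fun s => -(c' * w * g (i2 k m) (r4 k m s)))
      (w * (g (i3 k m) (i8 k m)
        - ∑ s, -(c' * w * g (i2 k m) (r4 k m s)) * g (r4 k m s) (i8 k m)))) ?_,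
      pow_mul_sub_mul_eq_zero_iff hU4678, Fin.sum_univ_castSucc]
    · simp only [Fin.snoc_last, Fin.snoc_castSucc]
    · intro t
      rw [Fin.sum_univ_castSucc]
      refine Fin.lastCases ?_ (fun t => ?_) t
      · simp only [Fin.snoc_last, Fin.snoc_castSucc]
        linear_combination (-(g (i3 k m) (i8 k m))
          + ∑ s, -(c' * w * g (i2 k m) (r4 k m s)) * g (r4 k m s) (i8 k m)) * hw
      · simp only [Fin.snoc_last, Fin.snoc_castSucc, hg76, mul_zero, add_zero, h36]
  simp only [SPoly, Set.mem_union, or_imp, forall_and, Set.forall_mem_range,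
    Set.mem_singleton_iff, forall_eq,
    map_neg_inverse_mul_eq_zero_iff f (isUnit_toLoc_of_dvd hd23),
    map_neg_inverse_mul_eq_zero_iff f (isUnit_toLoc_of_dvd hd78),
    map_pow_mul_inverse_mul_eq_zero_iff f (isUnit_toLoc_of_dvd hd46),
    map_pow_mul_inverse_mul_eq_zero_iff f (isUnit_toLoc_of_dvd hd2346),
    map_pow_mul_inverse_mul_eq_zero_iff f (isUnit_toLoc_of_dvd hd4678), hdet, hc, hgen]
  simp only [Matrix.det_fin_two, Matrix.submatrix_apply, Matrix.cons_val_zero,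
    Matrix.cons_val_one, map_add, map_sum, map_mul, hgen, hS47, Prod.forall,
    mul_sub_mul_eq_zero_iff hw]
  constructor
  · rintro ⟨⟨⟨⟨⟨⟨⟨⟨⟨⟨⟨⟨⟨⟨⟨⟨⟨⟨⟨⟨⟨h11, h44⟩, h66⟩, h99⟩, h12⟩, h14⟩, h15⟩, h17⟩, h34⟩, h35⟩, h37⟩, h39⟩,
      h45⟩, h56⟩, h57⟩, h59⟩, h67⟩, h69⟩, h89⟩, h36⟩, h47⟩, h23⟩
    have hu := hu23 h23
    have h36' := fun b => (hS36 h23 b).mp (h36 b)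
    exact
      { h11 := fun a b hab => h11 _ ⟨a, b, hab, rfl⟩
        h44 := fun a b hab => h44 _ ⟨a, b, hab, rfl⟩
        h66 := fun a b hab => h66 _ ⟨a, b, hab, rfl⟩
        h99 := fun a b hab => h99 _ ⟨a, b, hab, rfl⟩
        h12 := h12
        h14 := fun a b => (mul_sub_mul_eq_zero_iff hu).mp (h14 a b)
        h15 := fun a => (mul_sub_mul_eq_zero_iff hu).mp (h15 a)
        h17 := fun a => (hD17 h23 h47 a).mp (h17 a)
        h23 := h23
        h34 := h34
        h35 := h35
        h36 := h36'
        h37 := (hD37 h36').mp h37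
        h39 := fun b => (hD39 h36' b).mp (h39 b)
        h45 := h45
        h47 := h47
        h56 := h56
        h57 := h57
        h59 := h59
        h67 := h67
        h69 := h69
        h89 := h89 }
  · intro h
    have hu := hu23 h.h23
    refine ⟨⟨⟨⟨⟨⟨⟨⟨⟨⟨⟨⟨⟨⟨⟨⟨⟨⟨⟨⟨⟨?_, ?_⟩, ?_⟩, ?_⟩, h.h12⟩, fun a b => ?_⟩, fun a => ?_⟩, fun a => ?_⟩, h.h34⟩,
      h.h35⟩, ?_⟩, fun b => ?_⟩, h.h45⟩, h.h56⟩, h.h57⟩, h.h59⟩, h.h67⟩, h.h69⟩, h.h89⟩, fun b => ?_⟩,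
      h.h47⟩, h.h23⟩
    · rintro _ ⟨a, b, hab, rfl⟩
      exact h.h11 a b hab
    · rintro _ ⟨a, b, hab, rfl⟩
      exact h.h44 a b hab
    · rintro _ ⟨a, b, hab, rfl⟩
      exact h.h66 a b hab
    · rintro _ ⟨a, b, hab, rfl⟩
      exact h.h99 a b hab
    · exact (mul_sub_mul_eq_zero_iff hu).mpr (h.h14 a b)
    · exact (mul_sub_mul_eq_zero_iff hu).mpr (h.h15 a)
    · exact (hD17 h.h23 h.h47 a).mpr (h.h17 a)
    · exact (hD37 h.h36).mpr h.h37
    · exact (hD39 h.h36 b).mpr (h.h39 b)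
    · exact (hS36 h.h23 b).mpr (h.h36 b)

end Localized

/-- Proposition (odd case), primality part: the ideal `I'` of the localization `R'` of the
coordinate ring of `UT(2(k+m)+5,ℝ)` at the powers of `d₁` generated by the set `S` is prime. -/
theorem ideal_span_S_isPrime_odd (k m : ℕ) (hk : 1 ≤ k) (hm : 1 ≤ m)
    (γ₁ γ₂ : ℝ) (hγ₁ : γ₁ ≠ 0) (hγ₂ : γ₂ ≠ 0) :
    (Ideal.span (SPoly k m γ₁ γ₂)).IsPrime := by
  obtain ⟨w, hw⟩ := (isUnit_toLoc_of_dvd (k := k) (m := m)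
    (x := genMat (2*(k+m)+5) (i7 k m) (i8 k m)) (Dvd.intro_left _ rfl)).exists_left_inv
  set c := toLoc k m (MvPolynomial.C (γ₂ / γ₁))
  set c' := toLoc k m (MvPolynomial.C (γ₁ / γ₂))
  set g := (genMat (2*(k+m)+5)).map (toLoc k m)
  -- The substitution of the eliminated entries, and its extension to the localization.
  let φ : CoordRing (2*(k+m)+5) →+* LocRing k m :=
    MvPolynomial.eval₂Hom ((toLoc k m).comp MvPolynomial.C)
      fun p => elimEntry g c c' w p.1.1 p.1.2
  have hφC : ∀ r, φ (MvPolynomial.C r) = toLoc k m (MvPolynomial.C r) := fun r =>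
    MvPolynomial.eval₂Hom_C _ _ r
  have hφ : ∀ i j, i < j → φ (genMat _ i j) = elimEntry g c c' w i j := fun i j hij => by
    rw [genMat_apply_lt hij]
    exact MvPolynomial.eval₂Hom_X' _ _ _
  have hφ78 : φ (genMat _ (i7 k m) (i8 k m)) = toLoc k m (genMat _ (i7 k m) (i8 k m)) := by
    rw [hφ _ _ i7_lt_i8]
    simp [elimEntry, blk_i7, blk_i8, g]
  have hφ46 : φ ((genMat _).submatrix (r4 k m) (c6 k m)).det
      = toLoc k m ((genMat _).submatrix (r4 k m) (c6 k m)).det := by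
    rw [RingHom.map_det, RingHom.map_det]
    congr 1
    ext a b
    rw [RingHom.mapMatrix_apply, Matrix.map_apply, Matrix.submatrix_apply, hφ _ _ (r4_lt_c6 a b)]
    simp [elimEntry, blk_r4, blk_c6, g]
  have hunit : IsUnit (φ (dPoly k m)) := by
    have h23 : IsUnit (φ (genMat _ (i2 k m) (i3 k m))) := by
      rw [hφ _ _ i2_lt_i3]
      simp only [elimEntry, blk_i2, blk_i3]
      refine IsUnit.mul ?_ (isUnit_toLoc_of_dvd (Dvd.intro_left _ rfl))
      exact ((IsUnit.mk0 _ (div_ne_zero hγ₂ hγ₁)).map MvPolynomial.C).map (toLoc k m)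
    change IsUnit (φ (genMat _ (i2 k m) (i3 k m) * ((genMat _).submatrix (r4 k m) (c6 k m)).det
      * genMat _ (i7 k m) (i8 k m)))
    rw [map_mul, map_mul, hφ78, hφ46]
    exact (h23.mul (isUnit_toLoc_of_dvd ((Dvd.intro_left _ rfl).mul_right _))).mul
      (isUnit_toLoc_of_dvd (Dvd.intro_left _ rfl))
  let σ : LocRing k m →+* LocRing k m := IsLocalization.Away.lift (dPoly k m) hunit
  have hσ : ∀ x, σ (toLoc k m x) = φ x := fun x => IsLocalization.Away.lift_eq _ hunit x
  have hσS : ∀ s ∈ SPoly k m γ₁ γ₂, σ s = 0 := by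
    rw [forall_map_SPoly_eq_zero_iff hγ₁ hγ₂ σ (w := w) (by rw [hσ, hφ78, hw]), hσ, hσ, hφC, hφC]
    refine ElimRel.of_eq_elimEntry (g := g) fun i j hij => ?_
    rw [← hφ i j hij, ← hσ]
    rfl
  -- Modulo the ideal, the substitution is the identity.
  let π := Ideal.Quotient.mk (Ideal.span (SPoly k m γ₁ γ₂))
  have hrel := (forall_map_SPoly_eq_zero_iff hγ₁ hγ₂ π (w := π w)
    (by rw [← map_mul, hw, map_one])).mp
    fun s hs => Ideal.Quotient.eq_zero_iff_mem.mpr (Ideal.subset_span hs)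
  have hπσ : π.comp σ = π := by
    refine IsLocalization.ringHom_ext (Submonoid.powers (dPoly k m))
      (MvPolynomial.ringHom_ext (fun r => ?_) fun p => ?_)
    · exact congrArg π ((hσ _).trans (hφC r))
    · obtain ⟨⟨i, j⟩, hij⟩ := p
      change π (σ (toLoc k m _)) = π (toLoc k m _)
      rw [hσ, ← genMat_apply_lt hij, hφ i j hij, map_elimEntry]
      exact (hrel.eq_elimEntry hij).symm
  have hker : Ideal.span (SPoly k m γ₁ γ₂) = RingHom.ker σ := by
    refine le_antisymm (Ideal.span_le.mpr hσS) fun x hx => ?_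
    rw [← Ideal.Quotient.eq_zero_iff_mem]
    change π x = 0
    rw [← hπσ, RingHom.comp_apply, RingHom.mem_ker.mp hx, map_zero]
  rw [hker]
  exact RingHom.ker_isPrime σ

end
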